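/- There is a homeomorphism f from rep(F₂, SU(2)) onto the closed unit ball of ℝ³ such that, for every pair (a,b) ∈ S × S of unit quaternions, the point f([a,b-class]) lies on the unit sphere (the boundary of the ball) if and only if a and b commute. In particular, rep(F₂, SU(2)) is homeomorphic to a closed 3-ball whose boundary corresponds exactly to the abelian characters. -/

import Mathlib

noncomputable section

open Real

/-- The conjugation relation on pairs of elements of a group. -/
def ConjRel (G : Type) [Group G] (p q : G × G) : Prop :=
  ∃ g : G, q.1 = g * p.1 * g⁻¹ ∧ q.2 = g * p.2 * g⁻¹

/-- The `G`-character space of the free group of rank two: the quotient topological space of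
`G × G` by the conjugation action `g • (a, b) = (g a g⁻¹, g b g⁻¹)`. -/
abbrev RepF2 (G : Type) [Group G] [TopologicalSpace G] : Type :=
  Quotient (Relation.EqvGen.setoid (ConjRel G))

open scoped Quaternion

/-- The group `S` of unit quaternions (isomorphic to `SU(2)`). -/
abbrev SQ : Type := ↥(Metric.sphere (0 : ℍ[ℝ]) 1)

/-- `ℝ³` as a Euclidean space. -/
abbrev V3 : Type := EuclideanSpace ℝ (Fin 3)

/-- The Gram invariants `(Re a, Re b, ⟪a, b⟫)` of a pair of quaternions. -/
def gramVec (a b : ℍ[ℝ]) : V3 :=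
  !₂[a.re, b.re, a.re * b.re + a.imI * b.imI + a.imJ * b.imJ + a.imK * b.imK]

/-- The quadratic form with unit diagonal and off-diagonal coefficients `p`. -/
def elliptopeForm (p : V3) (u v w : ℝ) : ℝ :=
  u ^ 2 + v ^ 2 + w ^ 2 + 2 * (p 0 * (u * v) + p 1 * (u * w) + p 2 * (v * w))

/-- The elliptope: off-diagonal coefficients of the positive semidefinite `3 × 3` matrices with
unit diagonal. -/
def elliptope : Set V3 :=
  {p | ∀ u v w : ℝ, 0 ≤ elliptopeForm p u v w}

/-- The determinant of the matrix with unit diagonal and off-diagonal coefficients `p`. -/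
def elliptopeDet (p : V3) : ℝ :=
  (1 - p 0 ^ 2) * (1 - p 1 ^ 2) - (p 2 - p 0 * p 1) ^ 2

lemma sum_sq_eq_one (a : SQ) :
    a.1.re ^ 2 + a.1.imI ^ 2 + a.1.imJ ^ 2 + a.1.imK ^ 2 = 1 := by
  have h : ‖a.1‖ = 1 := mem_sphere_zero_iff_norm.1 a.2
  rw [← Quaternion.normSq_def', Quaternion.normSq_eq_norm_mul_self, h, mul_one]

lemma convex_elliptope : Convex ℝ elliptope := by
  intro p hp q hq s t hs ht hst u v w
  have h1 := mul_nonneg hs (hp u v w)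
  have h2 := mul_nonneg ht (hq u v w)
  obtain rfl : s = 1 - t := by linarith
  simp only [elliptopeForm, PiLp.add_apply, PiLp.smul_apply, smul_eq_mul] at *
  linarith

lemma isClosed_elliptope : IsClosed elliptope := by
  simp only [elliptope, Set.ofPred_forall]
  refine isClosed_iInter fun u => isClosed_iInter fun v => isClosed_iInter fun w => ?_
  refine isClosed_le continuous_const ?_
  unfold elliptopeForm
  fun_prop

lemma elliptope_bounds {p : V3} (hp : p ∈ elliptope) :
    p 0 ^ 2 ≤ 1 ∧ p 1 ^ 2 ≤ 1 ∧ p 2 ^ 2 ≤ 1 := by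
  have h1 := hp (-p 0) 1 0
  have h2 := hp (-p 1) 0 1
  have h3 := hp 0 (-p 2) 1
  simp only [elliptopeForm] at h1 h2 h3
  refine ⟨?_, ?_, ?_⟩ <;> linarith

lemma elliptopeDet_nonneg {p : V3} (hp : p ∈ elliptope) : 0 ≤ elliptopeDet p := by
  obtain ⟨h0, h1, h2⟩ := elliptope_bounds hp
  have h := hp (p 0 * p 2 - p 1) (p 0 * p 1 - p 2) (1 - p 0 ^ 2)
  have key : elliptopeForm p (p 0 * p 2 - p 1) (p 0 * p 1 - p 2) (1 - p 0 ^ 2) =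
      (1 - p 0 ^ 2) * elliptopeDet p := by
    simp only [elliptopeForm, elliptopeDet]; ring
  rw [key] at h
  rcases h0.lt_or_eq with h0 | h0
  · exact nonneg_of_mul_nonneg_right h (by linarith)
  · have hz : p 2 - p 0 * p 1 = 0 := by
      have hA : ∀ t : ℝ, 0 ≤ 1 + 2 * (t * (p 2 - p 0 * p 1)) := by
        intro t
        have := hp (-(p 0 * t) - p 1) t 1
        simp only [elliptopeForm] at this
        nlinarith [sq_nonneg (p 1)]
      by_contra hne
      have := hA (-1 / (p 2 - p 0 * p 1))
      field_simp at this
      linarith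
    simp [elliptopeDet, hz, h0]

lemma mem_elliptope_of_lt {p : V3} (h0 : p 0 ^ 2 < 1) (hd : 0 < elliptopeDet p) :
    p ∈ elliptope := by
  intro u v w
  have h : (1 - p 0 ^ 2) * elliptopeForm p u v w =
      (1 - p 0 ^ 2) * (u + p 0 * v + p 1 * w) ^ 2 +
        ((1 - p 0 ^ 2) * v + (p 2 - p 0 * p 1) * w) ^ 2 + elliptopeDet p * w ^ 2 := by
    simp only [elliptopeForm, elliptopeDet]; ring
  have h' : 0 < 1 - p 0 ^ 2 := by linarith
  refine nonneg_of_mul_nonneg_right (h ▸ ?_) h'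
  positivity

lemma continuous_elliptopeDet : Continuous elliptopeDet := by
  unfold elliptopeDet
  fun_prop

lemma mem_interior_elliptope {p : V3} (h0 : p 0 ^ 2 < 1) (hd : 0 < elliptopeDet p) :
    p ∈ interior elliptope := by
  refine mem_interior.2 ⟨{q | q 0 ^ 2 < 1} ∩ {q | 0 < elliptopeDet q},
    fun q hq => mem_elliptope_of_lt hq.1 hq.2, IsOpen.inter ?_ ?_, h0, hd⟩
  · exact isOpen_lt (by fun_prop) continuous_const
  · exact isOpen_lt continuous_const continuous_elliptopeDet

lemma exists_null_vector {p : V3} (hd : elliptopeDet p = 0) :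
    ∃ u v w : ℝ, 0 < u ^ 2 + v ^ 2 + w ^ 2 ∧ elliptopeForm p u v w = 0 := by
  by_cases h0 : p 0 ^ 2 = 1
  · exact ⟨p 0, -1, 0, by positivity, by simp only [elliptopeForm]; linarith⟩
  · refine ⟨p 0 * p 2 - p 1, p 0 * p 1 - p 2, 1 - p 0 ^ 2, ?_, ?_⟩
    · have : 1 - p 0 ^ 2 ≠ 0 := fun h => h0 (by linarith)
      positivity
    · have : elliptopeForm p (p 0 * p 2 - p 1) (p 0 * p 1 - p 2) (1 - p 0 ^ 2) =
          (1 - p 0 ^ 2) * elliptopeDet p := by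
        simp only [elliptopeForm, elliptopeDet]; ring
      rw [this, hd, mul_zero]

lemma notMem_interior_elliptope {p : V3} (hd : elliptopeDet p = 0) :
    p ∉ interior elliptope := by
  intro hp
  obtain ⟨u, v, w, hpos, hnull⟩ := exists_null_vector hd
  have hc : Filter.Tendsto (fun t : ℝ => t • p) (nhds 1) (nhds p) := by
    have : Continuous fun t : ℝ => t • p := by fun_prop
    simpa using this.tendsto 1
  have hev := hc.eventually (isOpen_interior.mem_nhds hp)
  obtain ⟨t, ht, h1t⟩ := ((hev.filter_mono nhdsWithin_le_nhds).and
    (self_mem_nhdsWithin : Set.Ioi (1 : ℝ) ∈ nhdsWithin 1 (Set.Ioi 1))).exists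
  have h := interior_subset ht u v w
  simp only [elliptopeForm, PiLp.smul_apply, smul_eq_mul] at h hnull
  have h1t : 1 < t := h1t
  nlinarith

lemma mem_frontier_elliptope_iff {p : V3} (hp : p ∈ elliptope) :
    p ∈ frontier elliptope ↔ elliptopeDet p = 0 := by
  rw [isClosed_elliptope.frontier_eq]
  refine ⟨fun h => ?_, fun h => ⟨hp, notMem_interior_elliptope h⟩⟩
  by_contra hne
  have hd := lt_of_le_of_ne (elliptopeDet_nonneg hp) (Ne.symm hne)
  refine h.2 (mem_interior_elliptope (lt_of_le_of_ne (elliptope_bounds hp).1 fun h0 => ?_) hd)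
  simp only [elliptopeDet, h0] at hd
  linarith [sq_nonneg (p 2 - p 0 * p 1)]

lemma isBounded_elliptope : Bornology.IsBounded elliptope := by
  refine (Metric.isBounded_closedBall (x := (0 : V3)) (r := 2)).subset fun p hp => ?_
  obtain ⟨h0, h1, h2⟩ := elliptope_bounds hp
  rw [mem_closedBall_zero_iff, EuclideanSpace.norm_eq, Real.sqrt_le_left (by norm_num)]
  simp only [Fin.sum_univ_three, Real.norm_eq_abs, sq_abs]
  linarith

lemma exists_homeomorph_elliptope :
    ∃ e : V3 ≃ₜ V3, e '' elliptope = Metric.closedBall 0 1 ∧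
      e '' frontier elliptope = Metric.sphere 0 1 := by
  have hne : (interior elliptope).Nonempty :=
    ⟨0, mem_interior_elliptope (by simp) (by simp [elliptopeDet])⟩
  obtain ⟨e, -, h1, h2⟩ := exists_homeomorph_image_interior_closure_frontier_eq_unitBall
    convex_elliptope hne isBounded_elliptope
  exact ⟨e, by rwa [isClosed_elliptope.closure_eq] at h1, h2⟩

lemma gramVec_mem_elliptope (a b : SQ) : gramVec a.1 b.1 ∈ elliptope := by
  intro u v w
  have ha := sum_sq_eq_one a
  have hb := sum_sq_eq_one b
  have : elliptopeForm (gramVec a.1 b.1) u v w =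
      (u + v * a.1.re + w * b.1.re) ^ 2 + (v * a.1.imI + w * b.1.imI) ^ 2 +
        (v * a.1.imJ + w * b.1.imJ) ^ 2 + (v * a.1.imK + w * b.1.imK) ^ 2 := by
    simp only [elliptopeForm, gramVec, PiLp.toLp_apply, Matrix.cons_val]
    linear_combination (-v ^ 2) * ha + (-w ^ 2) * hb
  rw [this]
  positivity

lemma elliptopeDet_gramVec (a b : SQ) :
    elliptopeDet (gramVec a.1 b.1) =
      (a.1.imJ * b.1.imK - a.1.imK * b.1.imJ) ^ 2 + (a.1.imK * b.1.imI - a.1.imI * b.1.imK) ^ 2 +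
        (a.1.imI * b.1.imJ - a.1.imJ * b.1.imI) ^ 2 := by
  have ha : 1 - a.1.re ^ 2 = a.1.imI ^ 2 + a.1.imJ ^ 2 + a.1.imK ^ 2 := by
    linarith [sum_sq_eq_one a]
  have hb : 1 - b.1.re ^ 2 = b.1.imI ^ 2 + b.1.imJ ^ 2 + b.1.imK ^ 2 := by
    linarith [sum_sq_eq_one b]
  simp only [elliptopeDet, gramVec, PiLp.toLp_apply, Matrix.cons_val]
  rw [ha, hb]
  ring

lemma elliptopeDet_gramVec_eq_zero_iff (a b : SQ) :
    elliptopeDet (gramVec a.1 b.1) = 0 ↔ a * b = b * a := by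
  rw [elliptopeDet_gramVec, Subtype.ext_iff, Quaternion.ext_iff]
  simp only [Metric.unitSphere.coe_mul, Quaternion.re_mul, Quaternion.imI_mul,
    Quaternion.imJ_mul, Quaternion.imK_mul]
  constructor
  · intro h
    have h1 : a.1.imJ * b.1.imK - a.1.imK * b.1.imJ = 0 := by nlinarith
    have h2 : a.1.imK * b.1.imI - a.1.imI * b.1.imK = 0 := by nlinarith
    have h3 : a.1.imI * b.1.imJ - a.1.imJ * b.1.imI = 0 := by nlinarith
    refine ⟨?_, ?_, ?_, ?_⟩ <;> linarith
  · rintro ⟨-, h1, h2, h3⟩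
    have h1 : a.1.imJ * b.1.imK - a.1.imK * b.1.imJ = 0 := by linarith
    have h2 : a.1.imK * b.1.imI - a.1.imI * b.1.imK = 0 := by linarith
    have h3 : a.1.imI * b.1.imJ - a.1.imJ * b.1.imI = 0 := by linarith
    rw [h1, h2, h3]; norm_num

/-- The quaternion with components `x, y, z, w`. -/
def quat (x y z w : ℝ) : ℍ[ℝ] := ⟨x, y, z, w⟩

@[simp] lemma quat_re (x y z w : ℝ) : (quat x y z w).re = x := rfl
@[simp] lemma quat_imI (x y z w : ℝ) : (quat x y z w).imI = y := rfl
@[simp] lemma quat_imJ (x y z w : ℝ) : (quat x y z w).imJ = z := rfl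
@[simp] lemma quat_imK (x y z w : ℝ) : (quat x y z w).imK = w := rfl

lemma exists_eq_quat (a : ℍ[ℝ]) : ∃ x y z w : ℝ, a = quat x y z w :=
  ⟨a.re, a.imI, a.imJ, a.imK, rfl⟩

lemma quat_mem_sphere {x y z w : ℝ} (h : x ^ 2 + y ^ 2 + z ^ 2 + w ^ 2 = 1) :
    quat x y z w ∈ Metric.sphere (0 : ℍ[ℝ]) 1 := by
  rw [mem_sphere_zero_iff_norm, ← sq_eq_sq₀ (norm_nonneg _) zero_le_one, sq,
    ← Quaternion.normSq_eq_norm_mul_self, Quaternion.normSq_def']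
  simpa using h

lemma exists_gramVec_eq {p : V3} (hp : p ∈ elliptope) : ∃ a b : SQ, gramVec a.1 b.1 = p := by
  obtain ⟨h0, h1, -⟩ := elliptope_bounds hp
  have hd := elliptopeDet_nonneg hp
  unfold elliptopeDet at hd
  set s := Real.sqrt (1 - p 0 ^ 2) with hs
  have hs2 : s ^ 2 = 1 - p 0 ^ 2 := Real.sq_sqrt (by linarith)
  obtain ⟨c, hc, hc2⟩ : ∃ c : ℝ, s * c = p 2 - p 0 * p 1 ∧ c ^ 2 ≤ 1 - p 1 ^ 2 := by
    by_cases hs0 : s = 0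
    · refine ⟨0, ?_, by linarith⟩
      rw [hs0] at hs2
      have : (p 2 - p 0 * p 1) ^ 2 = 0 :=
        le_antisymm (by nlinarith) (sq_nonneg _)
      rw [mul_zero, pow_eq_zero_iff two_ne_zero |>.1 this]
    · refine ⟨(p 2 - p 0 * p 1) / s, by field_simp, ?_⟩
      rw [div_pow, div_le_iff₀ (by positivity), hs2]
      linarith
  set t := Real.sqrt (1 - p 1 ^ 2 - c ^ 2)
  have ht2 : t ^ 2 = 1 - p 1 ^ 2 - c ^ 2 := Real.sq_sqrt (by linarith)
  refine ⟨⟨quat (p 0) s 0 0, quat_mem_sphere (by linarith)⟩,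
    ⟨quat (p 1) c t 0, quat_mem_sphere (by linarith)⟩, ?_⟩
  ext i
  fin_cases i <;> simp [gramVec, hc]

lemma re_conj (g a : SQ) : (g * a * g⁻¹).1.re = a.1.re := by
  have h : ∀ x y : SQ, (x * y).1.re = (y * x).1.re := by
    intro x y
    simp only [Metric.unitSphere.coe_mul, Quaternion.re_mul]
    ring
  rw [h, inv_mul_cancel_left]

lemma gramVec_eq (a b : SQ) :
    gramVec a.1 b.1 = !₂[a.1.re, b.1.re, 2 * (a.1.re * b.1.re) - (a * b).1.re] := by
  simp only [gramVec, Metric.unitSphere.coe_mul, Quaternion.re_mul]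
  congr 4
  ring

lemma gramVec_eq_of_conjRel {p q : SQ × SQ} (h : ConjRel SQ p q) :
    gramVec p.1.1 p.2.1 = gramVec q.1.1 q.2.1 := by
  obtain ⟨g, h1, h2⟩ := h
  have h3 : q.1 * q.2 = g * (p.1 * p.2) * g⁻¹ := by rw [h1, h2]; group
  rw [gramVec_eq, gramVec_eq, h3, h1, h2, re_conj, re_conj, re_conj]

/-- Nonzero intertwiners between pairs of unit quaternions give conjugate pairs. -/
lemma conjRel_of_intertwiner {a b c d : SQ} {g : ℍ[ℝ]} (hg : g ≠ 0)
    (h1 : g * a.1 = c.1 * g) (h2 : g * b.1 = d.1 * g) : ConjRel SQ (a, b) (c, d) := by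
  have hn : ‖g‖ ≠ 0 := norm_ne_zero_iff.2 hg
  have key : ∀ x y : SQ, g * x.1 = y.1 * g → ∀ k : SQ, k.1 = ‖g‖⁻¹ • g → y = k * x * k⁻¹ := by
    intro x y h k hk
    rw [eq_mul_inv_iff_mul_eq, Subtype.ext_iff]
    simp [hk, h]
  refine ⟨⟨‖g‖⁻¹ • g, by simp [norm_smul, hn]⟩, key a c h1 _ rfl, key b d h2 _ rfl⟩

/-- Quaternions with the same real part and the same norm are intertwined. -/
lemma exists_intertwiner_of_re_eq {a c : ℍ[ℝ]} (h : a.re = c.re)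
    (hn : a.imI ^ 2 + a.imJ ^ 2 + a.imK ^ 2 = c.imI ^ 2 + c.imJ ^ 2 + c.imK ^ 2) :
    ∃ g : ℍ[ℝ], g ≠ 0 ∧ g * a = c * g := by
  obtain ⟨r, a1, a2, a3, rfl⟩ := exists_eq_quat a
  obtain ⟨r', c1, c2, c3, rfl⟩ := exists_eq_quat c
  obtain rfl : r = r' := h
  simp only [quat_imI, quat_imJ, quat_imK] at hn
  by_cases hs : a1 + c1 = 0 ∧ a2 + c2 = 0 ∧ a3 + c3 = 0
  · obtain ⟨h1, h2, h3⟩ := hs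
    obtain rfl : c1 = -a1 := by linarith
    obtain rfl : c2 = -a2 := by linarith
    obtain rfl : c3 = -a3 := by linarith
    by_cases ha : a1 = 0 ∧ a2 = 0
    · obtain ⟨rfl, rfl⟩ := ha
      refine ⟨quat 0 1 0 0, fun h => by simpa using congrArg (·.imI) h, ?_⟩
      ext <;> simp
    · refine ⟨quat 0 (-a2) a1 0, fun h => ha ⟨?_, ?_⟩, ?_⟩
      · simpa using congrArg (·.imJ) h
      · simpa using congrArg (·.imI) h
      · ext <;> simp <;> ring
  · refine ⟨quat 0 (a1 + c1) (a2 + c2) (a3 + c3), fun h => hs ⟨?_, ?_, ?_⟩, ?_⟩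
    · simpa using congrArg (·.imI) h
    · simpa using congrArg (·.imJ) h
    · simpa using congrArg (·.imK) h
    · ext <;> simp
      · linear_combination -hn
      all_goals ring

/-- If `b` and `d` have the same real part, the same norm and the same inner product with the
imaginary part of `a`, they are intertwined by a quaternion commuting with `a`. -/
lemma exists_intertwiner_commute {a b d : ℍ[ℝ]} (h : b.re = d.re)
    (hn : b.imI ^ 2 + b.imJ ^ 2 + b.imK ^ 2 = d.imI ^ 2 + d.imJ ^ 2 + d.imK ^ 2)
    (hi : a.imI * b.imI + a.imJ * b.imJ + a.imK * b.imK =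
      a.imI * d.imI + a.imJ * d.imJ + a.imK * d.imK) :
    ∃ g : ℍ[ℝ], g ≠ 0 ∧ g * a = a * g ∧ g * b = d * g := by
  by_cases ha : a.imI = 0 ∧ a.imJ = 0 ∧ a.imK = 0
  · obtain ⟨g, hg, hgb⟩ := exists_intertwiner_of_re_eq h hn
    refine ⟨g, hg, ?_, hgb⟩
    obtain ⟨h1, h2, h3⟩ := ha
    ext <;> simp [h1, h2, h3, mul_comm]
  obtain ⟨x, a1, a2, a3, rfl⟩ := exists_eq_quat a
  obtain ⟨y, b1, b2, b3, rfl⟩ := exists_eq_quat b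
  obtain ⟨y', d1, d2, d3, rfl⟩ := exists_eq_quat d
  obtain rfl : y = y' := h
  simp only [quat_imI, quat_imJ, quat_imK] at hn hi ha
  obtain ⟨p1, hp1⟩ : ∃ p1, p1 = a2 * (b3 + d3) - a3 * (b2 + d2) := ⟨_, rfl⟩
  obtain ⟨p2, hp2⟩ : ∃ p2, p2 = a3 * (b1 + d1) - a1 * (b3 + d3) := ⟨_, rfl⟩
  obtain ⟨p3, hp3⟩ : ∃ p3, p3 = a1 * (b2 + d2) - a2 * (b1 + d1) := ⟨_, rfl⟩
  by_cases hp : p1 = 0 ∧ p2 = 0 ∧ p3 = 0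
  · obtain ⟨h1, h2, h3⟩ := hp
    refine ⟨quat 0 a1 a2 a3, fun h => ha ⟨?_, ?_, ?_⟩, ?_, ?_⟩
    · simpa using congrArg (·.imI) h
    · simpa using congrArg (·.imJ) h
    · simpa using congrArg (·.imK) h
    · ext <;> simp <;> ring
    · ext <;> simp <;> linarith
  · obtain ⟨t, ht⟩ : ∃ t, t = (b1 - d1) * p1 + (b2 - d2) * p2 + (b3 - d3) * p3 := ⟨_, rfl⟩
    have f1 : p2 * (b3 - d3) - p3 * (b2 - d2) = 0 := by
      linear_combination (b1 + d1) * hi - a1 * hn + (b3 - d3) * hp2 - (b2 - d2) * hp3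
    have f2 : p3 * (b1 - d1) - p1 * (b3 - d3) = 0 := by
      linear_combination (b2 + d2) * hi - a2 * hn + (b1 - d1) * hp3 - (b3 - d3) * hp1
    have f3 : p1 * (b2 - d2) - p2 * (b1 - d1) = 0 := by
      linear_combination (b3 + d3) * hi - a3 * hn + (b2 - d2) * hp1 - (b1 - d1) * hp2
    have e1 : (p1 ^ 2 + p2 ^ 2 + p3 ^ 2) * (b1 - d1) = t * p1 := by
      linear_combination p3 * f2 - p2 * f3 - p1 * ht
    have e2 : (p1 ^ 2 + p2 ^ 2 + p3 ^ 2) * (b2 - d2) = t * p2 := by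
      linear_combination p1 * f3 - p3 * f1 - p2 * ht
    have e3 : (p1 ^ 2 + p2 ^ 2 + p3 ^ 2) * (b3 - d3) = t * p3 := by
      linear_combination p2 * f1 - p1 * f2 - p3 * ht
    refine ⟨quat (p1 ^ 2 + p2 ^ 2 + p3 ^ 2) (-(t * a1)) (-(t * a2)) (-(t * a3)),
      fun h => hp ?_, ?_, ?_⟩
    · have h0 : p1 ^ 2 + p2 ^ 2 + p3 ^ 2 = 0 := by simpa using congrArg (·.re) h
      refine ⟨?_, ?_, ?_⟩ <;> refine (pow_eq_zero_iff two_ne_zero).1 ?_ <;>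
        linarith [sq_nonneg p1, sq_nonneg p2, sq_nonneg p3]
    · ext <;> simp <;> ring
    · ext <;> simp
      · linear_combination t * hi
      · linear_combination e1 + t * hp1
      · linear_combination e2 + t * hp2
      · linear_combination e3 + t * hp3

lemma conjRel_trans {G : Type} [Group G] {p q r : G × G} (h1 : ConjRel G p q)
    (h2 : ConjRel G q r) : ConjRel G p r := by
  obtain ⟨g, hg1, hg2⟩ := h1
  obtain ⟨k, hk1, hk2⟩ := h2
  exact ⟨k * g, by rw [hk1, hg1]; group, by rw [hk2, hg2]; group⟩

lemma conjRel_of_gramVec_eq {p q : SQ × SQ} (h : gramVec p.1.1 p.2.1 = gramVec q.1.1 q.2.1) :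
    ConjRel SQ p q := by
  obtain ⟨a, b⟩ := p
  obtain ⟨c, d⟩ := q
  have hre : a.1.re = c.1.re := by simpa [gramVec] using congrArg (· 0) h
  obtain ⟨g, hg, hga⟩ := exists_intertwiner_of_re_eq hre (by
    have := sum_sq_eq_one a
    have := sum_sq_eq_one c
    rw [hre] at *
    linarith)
  obtain ⟨k, hk⟩ : ∃ k : SQ, c = k * a * k⁻¹ := by
    obtain ⟨k, hk, -⟩ := conjRel_of_intertwiner hg hga hga
    exact ⟨k, hk⟩
  have hab : ConjRel SQ (a, b) (c, k * b * k⁻¹) := ⟨k, hk, rfl⟩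
  refine conjRel_trans hab ?_
  have h' := (gramVec_eq_of_conjRel hab).symm.trans h
  generalize k * b * k⁻¹ = b' at h'
  have h1 : b'.1.re = d.1.re := by simpa [gramVec] using congrArg (· 1) h'
  have h2 := congrArg (· 2) h'
  simp only [gramVec, PiLp.toLp_apply, Matrix.cons_val, h1] at h2
  obtain ⟨l, hl, hlc, hlb⟩ := exists_intertwiner_commute (a := c.1) h1 (by
    have hb := sum_sq_eq_one b'
    have hd := sum_sq_eq_one d
    rw [h1] at hb
    linarith) (by linarith)
  exact conjRel_of_intertwiner hl hlc hlb

lemma continuous_gramVec : Continuous fun p : SQ × SQ => gramVec p.1.1 p.2.1 := by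
  have h1 := Quaternion.continuous_re
  have h2 := Quaternion.continuous_imI
  have h3 := Quaternion.continuous_imJ
  have h4 := Quaternion.continuous_imK
  refine (PiLp.continuous_toLp 2 _).comp (continuous_pi fun i => ?_)
  fin_cases i <;> simp <;> fun_prop

/-- `rep(F₂, SU(2))` is homeomorphic to the closed unit 3-ball, with the
boundary sphere corresponding exactly to the abelian characters. -/
theorem repF2_SU2_homeomorph_ball :
    ∃ f : RepF2 SQ ≃ₜ ↥(Metric.closedBall (0 : V3) 1),
      ∀ a b : SQ,
        ((f (Quotient.mk (Relation.EqvGen.setoid (ConjRel SQ)) (a, b)) : V3)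
            ∈ Metric.sphere (0 : V3) 1 ↔ a * b = b * a) := by
  obtain ⟨e, he, hfr⟩ := exists_homeomorph_elliptope
  let F : SQ × SQ → ↥(Metric.closedBall (0 : V3) 1) := fun p =>
    ⟨e (gramVec p.1.1 p.2.1), he ▸ Set.mem_image_of_mem e (gramVec_mem_elliptope p.1 p.2)⟩
  have hF : Continuous F := (e.continuous.comp continuous_gramVec).subtype_mk _
  have hFr : ∀ p q, Relation.EqvGen (ConjRel SQ) p q → F p = F q := by
    intro p q h
    induction h with
    | rel p q h => exact Subtype.ext (congrArg e (gramVec_eq_of_conjRel h))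
    | refl p => rfl
    | symm p q _ ih => exact ih.symm
    | trans p q r _ _ ih1 ih2 => exact ih1.trans ih2
  let Fq : RepF2 SQ → ↥(Metric.closedBall (0 : V3) 1) := Quotient.lift F hFr
  have hFq : Continuous Fq := hF.quotient_lift hFr
  have hbij : Function.Bijective Fq := by
    constructor
    · rintro ⟨p⟩ ⟨q⟩ h
      exact Quotient.sound (Relation.EqvGen.rel _ _
        (conjRel_of_gramVec_eq (e.injective (congrArg Subtype.val h))))
    · rintro ⟨y, hy⟩
      rw [← he] at hy
      obtain ⟨p, hp, rfl⟩ := hy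
      obtain ⟨a, b, rfl⟩ := exists_gramVec_eq hp
      exact ⟨Quotient.mk _ (a, b), rfl⟩
  refine ⟨Continuous.homeoOfEquivCompactToT2 (f := Equiv.ofBijective Fq hbij) hFq,
    fun a b => ?_⟩
  change e (gramVec a.1 b.1) ∈ _ ↔ _
  rw [← hfr, e.injective.mem_set_image, mem_frontier_elliptope_iff (gramVec_mem_elliptope a b),
    elliptopeDet_gramVec_eq_zero_iff]
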